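/- arXiv:math/9908097 — 2 statements merged into one kernel-verified Lean document; each statement's English description precedes it below -/
import Mathlib

section
/- Let r ≥ 1 be an integer, ζ ∈ ℂ a primitive r-th root of unity, and k an integer with 1 ≤ k ≤ r. Then the sum over a = 1, …, r−1 of ζ^{ak}/(1 − ζ^a) equals k − (r+1)/2. -/
/-- A nontrivial `r`-th root of unity has its nontrivial powers summing to `-1`. -/
lemma sum_Ico_one_pow_eq_neg_one {r : ℕ} (hr : 1 ≤ r) {x : ℂ} (hx : x ^ r = 1) (hx1 : x ≠ 1) :
    ∑ a ∈ Finset.Ico 1 r, x ^ a = -1 := by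
  have hgeom : ∑ a ∈ Finset.range r, x ^ a = 0 := by
    have h := geom_sum_mul x r
    rw [hx, sub_self] at h
    exact (mul_eq_zero.mp h).resolve_right (sub_ne_zero.mpr hx1)
  rw [Finset.range_eq_Ico, Finset.sum_eq_sum_Ico_succ_bot (by omega), pow_zero] at hgeom
  linear_combination hgeom

/-- The case `k = 1`, obtained by pairing the index `a` with `r - a`. -/
lemma sum_pow_div_one_sub_pow {r : ℕ} (hr : 1 ≤ r) {ζ : ℂ}
    (hζ1 : ζ ^ r = 1) (hζ2 : ∀ d : ℕ, 1 ≤ d → d < r → ζ ^ d ≠ 1) :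
    ∑ a ∈ Finset.Ico 1 r, ζ ^ a / (1 - ζ ^ a) = (1 - (r : ℂ)) / 2 := by
  have hreflect : ∑ a ∈ Finset.Ico 1 r, ζ ^ a / (1 - ζ ^ a) =
      ∑ a ∈ Finset.Ico 1 r, ζ ^ (r - a) / (1 - ζ ^ (r - a)) := by
    refine Finset.sum_nbij' (r - ·) (r - ·) ?_ ?_ ?_ ?_ ?_ <;> intro a ha <;>
      rw [Finset.mem_Ico] at ha
    · exact Finset.mem_Ico.mpr (by omega)
    · exact Finset.mem_Ico.mpr (by omega)
    · exact Nat.sub_sub_self ha.2.le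
    · exact Nat.sub_sub_self ha.2.le
    · simp only [Nat.sub_sub_self ha.2.le]
  have hpair : ∑ a ∈ Finset.Ico 1 r,
      (ζ ^ a / (1 - ζ ^ a) + ζ ^ (r - a) / (1 - ζ ^ (r - a))) = ∑ a ∈ Finset.Ico 1 r, (-1 : ℂ) := by
    refine Finset.sum_congr rfl fun a ha => ?_
    rw [Finset.mem_Ico] at ha
    have hmul : ζ ^ a * ζ ^ (r - a) = 1 := by rw [← pow_add, Nat.add_sub_cancel' ha.2.le, hζ1]
    have h₁ : 1 - ζ ^ a ≠ 0 := sub_ne_zero.mpr (hζ2 a ha.1 ha.2).symm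
    have h₂ : 1 - ζ ^ (r - a) ≠ 0 :=
      sub_ne_zero.mpr (hζ2 (r - a) (by omega) (by omega)).symm
    rw [div_add_div _ _ h₁ h₂, div_eq_iff (mul_ne_zero h₁ h₂)]
    linear_combination -hmul
  rw [Finset.sum_add_distrib, ← hreflect, Finset.sum_const, Nat.card_Ico, nsmul_eq_mul,
    Nat.cast_sub hr, Nat.cast_one] at hpair
  linear_combination hpair / 2

/-- **Root of unity identity** (proof of Corollary 3.41): for `ζ` a primitive `r`-th root of
unity in `ℂ` and `1 ≤ k ≤ r`, one has `∑_{a=1}^{r-1} ζ^{ak}/(1 - ζ^a) = k - (r+1)/2`. -/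
theorem sum_primitiveRoot_pow_div_one_sub (r : ℕ) (hr : 1 ≤ r) (ζ : ℂ)
    (hζ1 : ζ ^ r = 1) (hζ2 : ∀ d : ℕ, 1 ≤ d → d < r → ζ ^ d ≠ 1)
    (k : ℕ) (hk1 : 1 ≤ k) (hkr : k ≤ r) :
    ∑ a ∈ Finset.Ico 1 r, ζ ^ (a * k) / (1 - ζ ^ a) = (k : ℂ) - ((r : ℂ) + 1) / 2 := by
  induction k, hk1 using Nat.le_induction with
  | base =>
    simp only [mul_one, Nat.cast_one]
    rw [sum_pow_div_one_sub_pow hr hζ1 hζ2]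
    ring
  | succ k hk ih =>
    have hsum := sum_Ico_one_pow_eq_neg_one hr (x := ζ ^ k)
      (by rw [pow_right_comm, hζ1, one_pow]) (hζ2 k hk hkr)
    have hdiff : ∑ a ∈ Finset.Ico 1 r, ζ ^ (a * (k + 1)) / (1 - ζ ^ a) =
        ∑ a ∈ Finset.Ico 1 r, (ζ ^ (a * k) / (1 - ζ ^ a) - (ζ ^ k) ^ a) := by
      refine Finset.sum_congr rfl fun a ha => ?_
      rw [Finset.mem_Ico] at ha
      have h : 1 - ζ ^ a ≠ 0 := sub_ne_zero.mpr (hζ2 a ha.1 ha.2).symm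
      rw [← pow_mul, mul_comm k a, div_sub' h, div_left_inj' h]
      ring
    rw [hdiff, Finset.sum_sub_distrib, hsum, ih (by omega)]
    push_cast
    ring
end

section
/- Let A be a Noetherian local commutative ring with maximal ideal m, and let G be a finite group acting faithfully on A by ring automorphisms. Then there exists an integer n ≥ 1 such that the induced action of G on the quotient ring A/mⁿ is faithful, i.e. the homomorphism from G to the group of ring automorphisms of A/mⁿ is injective. -/
/-- **Faithfulness on jets** (algebraic content of the proof of Lemma 3.28): if a finite
group `G` acts faithfully by ring automorphisms on a Noetherian local ring `A` with maximal
ideal `m`, then for some `n ≥ 1` the induced action of `G` on `A/mⁿ` is faithful, i.e. any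
`g` acting trivially modulo `mⁿ` is the identity. -/
theorem exists_faithful_action_on_quotient {A : Type*} [CommRing A] [IsNoetherianRing A]
    [IsLocalRing A] {G : Type*} [Group G] [Finite G]
    (φ : G →* RingAut A) (hφ : Function.Injective φ) :
    ∃ n : ℕ, 1 ≤ n ∧ ∀ g : G,
      (∀ a : A, Ideal.Quotient.mk ((IsLocalRing.maximalIdeal A) ^ n) (φ g a) =
        Ideal.Quotient.mk ((IsLocalRing.maximalIdeal A) ^ n) a) → g = 1 := by
  have h_sep : ∀ g : G, ∃ N : ℕ, g ≠ 1 →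
      ∃ a : A, φ g a - a ∉ (IsLocalRing.maximalIdeal A) ^ N := by
    intro g
    by_contra! h
    refine (h 0).1 (hφ ?_)
    ext a
    have h_mem : φ g a - a ∈ ⨅ i : ℕ, (IsLocalRing.maximalIdeal A) ^ i :=
      Ideal.mem_iInf.mpr fun i => (h i).2 a
    rw [Ideal.iInf_pow_eq_bot_of_isLocalRing _ Ideal.IsPrime.ne_top', Ideal.mem_bot,
      sub_eq_zero] at h_mem
    simpa using h_mem
  choose N hN using h_sep
  obtain ⟨M, hM⟩ := (Set.finite_range N).bddAbove
  refine ⟨M + 1, Nat.le_add_left 1 M, fun g hg => ?_⟩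
  by_contra hne
  obtain ⟨a, ha⟩ := hN g hne
  have h_le : N g ≤ M + 1 := (hM (Set.mem_range_self g)).trans M.le_succ
  exact ha (Ideal.pow_le_pow_right h_le (Ideal.Quotient.eq.mp (hg a)))
end
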